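/- arXiv:2203.07916 — 12 statements merged into one kernel-verified Lean document; each statement's English description precedes it below -/
import Mathlib

section
/- For all x ∈ (0, π/2] and all y ∈ (0, π] one has x − arcsin((sin x)(cos y)) ≥ (2/π²)·x·y². -/
open Real

theorem sin_mul_mul_cos_le {d x : ℝ} (hd0 : 0 ≤ d) (hd1 : d ≤ 1) (hx0 : 0 ≤ x)
    (hx : x ≤ π / 2) : sin (d * x) * cos x ≤ d * cos (d * x) * sin x := by
  have hder (z : ℝ) : HasDerivAt (fun z => d * cos (d * z) * sin z - sin (d * z) * cos z)
      ((1 - d ^ 2) * (sin (d * z) * sin z)) z := by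
    have h : HasDerivAt (fun z => d * z) d z := by simpa using (hasDerivAt_id z).const_mul d
    refine (((h.cos.const_mul d).mul (hasDerivAt_sin z)).sub
      (h.sin.mul (hasDerivAt_cos z))).congr_deriv ?_
    ring
  have hmono : MonotoneOn (fun z => d * cos (d * z) * sin z - sin (d * z) * cos z)
      (Set.Icc 0 (π / 2)) := by
    refine monotoneOn_of_deriv_nonneg (convex_Icc _ _)
      (fun z _ => (hder z).continuousAt.continuousWithinAt)
      (fun z _ => (hder z).differentiableAt.differentiableWithinAt) fun z hz => ?_
    rw [interior_Icc] at hz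
    rw [(hder z).deriv]
    have hz0 := hz.1
    have hz1 := hz.2
    have h1 : 0 ≤ sin z := sin_nonneg_of_nonneg_of_le_pi hz0.le (by linarith)
    have h2 : 0 ≤ sin (d * z) :=
      sin_nonneg_of_nonneg_of_le_pi (by positivity) (by nlinarith)
    have h3 : 0 ≤ 1 - d ^ 2 := by nlinarith
    positivity
  have := hmono ⟨le_rfl, by positivity⟩ ⟨hx0, hx⟩ hx0
  simp at this
  linarith

theorem sin_mul_le_sin_mul_sin {d x : ℝ} (hd0 : 0 ≤ d) (hd1 : d ≤ 1) (hx0 : 0 < x)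
    (hx : x ≤ π / 2) : sin (d * x) ≤ sin x * sin (d * (π / 2)) := by
  have hpos {z : ℝ} (hz : z ∈ Set.Ioc 0 (π / 2)) : 0 < sin z :=
    sin_pos_of_pos_of_lt_pi hz.1 (by linarith [hz.2, pi_pos])
  have hder {z : ℝ} (hz : z ∈ Set.Ioc 0 (π / 2)) :
      HasDerivAt (fun z => sin (d * z) / sin z)
        ((d * cos (d * z) * sin z - sin (d * z) * cos z) / sin z ^ 2) z := by
    have h : HasDerivAt (fun z => d * z) d z := by simpa using (hasDerivAt_id z).const_mul d
    refine (h.sin.div (hasDerivAt_sin z) (hpos hz).ne').congr_deriv ?_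
    ring
  have hmono : MonotoneOn (fun z => sin (d * z) / sin z) (Set.Ioc 0 (π / 2)) := by
    refine monotoneOn_of_deriv_nonneg (convex_Ioc _ _)
      (fun z hz => (hder hz).continuousAt.continuousWithinAt)
      (fun z hz => (hder (interior_subset hz)).differentiableAt.differentiableWithinAt)
      fun z hz => ?_
    have hz' := interior_subset hz
    rw [(hder hz').deriv]
    have := sin_mul_mul_cos_le hd0 hd1 hz'.1.le hz'.2
    exact div_nonneg (by linarith) (by positivity)
  have := hmono ⟨hx0, hx⟩ ⟨by positivity, le_rfl⟩ hx
  simp only [sin_pi_div_two, div_one] at this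
  rwa [div_le_iff₀ (hpos ⟨hx0, hx⟩), mul_comm _ (sin x)] at this

theorem mul_sin_le_sin_mul {c x : ℝ} (hc0 : 0 ≤ c) (hc1 : c ≤ 1) (hx0 : 0 ≤ x) (hx : x ≤ π) :
    c * sin x ≤ sin (c * x) := by
  have := strictConcaveOn_sin_Icc.concaveOn.2 ⟨le_rfl, pi_pos.le⟩ ⟨hx0, hx⟩
    (sub_nonneg.2 hc1) hc0 (by ring)
  simpa using this

/-- For all x ∈ (0, π/2] and all y ∈ (0, π] one has
x − arcsin((sin x)(cos y)) ≥ (2/π²)·x·y². -/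
theorem stmt_5 (x y : ℝ) (hx : x ∈ Set.Ioc 0 (π/2)) (hy : y ∈ Set.Ioc 0 π) :
    x - Real.arcsin (Real.sin x * Real.cos y) ≥ (2 / π ^ 2) * x * y ^ 2 := by
  obtain ⟨hx0, hx1⟩ := hx
  obtain ⟨hy0, hy1⟩ := hy
  have hsin : 0 ≤ sin x := sin_nonneg_of_nonneg_of_le_pi hx0.le (by linarith)
  obtain ⟨c, hc⟩ : ∃ c, c = 1 - 2 / π ^ 2 * y ^ 2 := ⟨_, rfl⟩
  have hc1 : c ≤ 1 := by
    have : 0 ≤ 2 / π ^ 2 * y ^ 2 := by positivity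
    linarith
  have hcm1 : -1 ≤ c := by
    have : 2 / π ^ 2 * y ^ 2 ≤ 2 / π ^ 2 * π ^ 2 := by gcongr
    have h2 : 2 / π ^ 2 * π ^ 2 = 2 := by field_simp
    linarith
  have key : sin x * cos y ≤ sin (c * x) := by
    rcases le_total 0 c with h | h
    · have h1 := mul_sin_le_sin_mul h hc1 hx0.le (by linarith)
      have h2 : cos y ≤ c := by
        rw [hc]
        exact cos_le_one_sub_mul_cos_sq (by rwa [abs_of_pos hy0])
      nlinarith
    · have h1 := sin_mul_le_sin_mul_sin (neg_nonneg.2 h) (by linarith) hx0 hx1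
      simp only [neg_mul, sin_neg] at h1
      have h2 : cos y ≤ sin (c * (π / 2)) := by
        rw [← sin_pi_div_two_sub]
        have h3 : c * (π / 2) = π / 2 - y * (y / π) := by
          rw [hc]
          field_simp
        have h4 : y * (y / π) ≤ y :=
          mul_le_of_le_one_right hy0.le ((div_le_one pi_pos).2 hy1)
        have h5 : c * (π / 2) ≤ π / 2 := by nlinarith [pi_pos]
        exact sin_le_sin_of_le_of_le_pi_div_two (by linarith) h5 (by linarith)
      nlinarith
  have hle : arcsin (sin x * cos y) ≤ c * x := by
    rw [← arcsin_sin (x := c * x) (by nlinarith) (by nlinarith)]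
    exact monotone_arcsin key
  rw [hc] at hle
  linarith
end

section
/- The function g(x,y) := (x − arcsin((sin x)(cos y)))/(x·y²) − 1/2 satisfies g(x,y) = o(√(x² + y²)) as (x,y) → (0,0) within the open quadrant (0,∞)²; that is, for every c > 0 there exists δ > 0 such that for all x, y ∈ (0,δ) one has |(x − arcsin((sin x)(cos y)))/(x·y²) − 1/2| ≤ c·√(x² + y²). In particular, (x − arcsin((sin x)(cos y)))/(x·y²) → 1/2 as (x,y) → (0,0) with x, y > 0. -/
open Real Filter

/-- On `[0, π]`, where the cosine decreases, `sin` grows at least at the rate of the right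
endpoint. -/
theorem cos_mul_sub_le_sin_sub_sin {a x : ℝ} (ha : 0 ≤ a) (hax : a ≤ x) (hx : x ≤ π) :
    Real.cos x * (x - a) ≤ Real.sin x - Real.sin a := by
  rcases hax.eq_or_lt with rfl | hlt
  · simp
  · obtain ⟨ξ, hξ, h⟩ := exists_hasDerivAt_eq_slope Real.sin Real.cos hlt
      Real.continuous_sin.continuousOn (fun t _ => Real.hasDerivAt_sin t)
    rw [eq_div_iff (sub_pos.2 hlt).ne'] at h
    rw [← h]
    exact mul_le_mul_of_nonneg_right
      (Real.cos_le_cos_of_nonneg_of_le_pi (ha.trans hξ.1.le) hx hξ.2.le) (sub_nonneg.2 hax)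

/-- The increments of `sin` are at most those of its argument. -/
theorem sin_sub_sin_le_sub {a x : ℝ} (hax : a ≤ x) : Real.sin x - Real.sin a ≤ x - a := by
  rcases hax.eq_or_lt with rfl | hlt
  · simp
  · obtain ⟨ξ, -, h⟩ := exists_hasDerivAt_eq_slope Real.sin Real.cos hlt
      Real.continuous_sin.continuousOn (fun t _ => Real.hasDerivAt_sin t)
    rw [eq_div_iff (sub_pos.2 hlt).ne'] at h
    rw [← h]
    exact mul_le_of_le_one_left (sub_nonneg.2 hax) (Real.cos_le_one ξ)

/-- Quadratic error bound for the quotient `(x - arcsin (sin x * cos y)) / (x * y ^ 2)`. -/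
theorem abs_sub_arcsin_sin_mul_cos_div_sub_half_le {x y : ℝ} (hx : 0 < x) (hx1 : x ≤ 1)
    (hy : 0 < y) (hy1 : y ≤ 1) :
    |(x - Real.arcsin (Real.sin x * Real.cos y)) / (x * y ^ 2) - 1/2| ≤ (x ^ 2 + y ^ 2) / 2 := by
  have hpi := Real.pi_gt_three
  have hsx : 0 < Real.sin x := Real.sin_pos_of_pos_of_lt_pi hx (by linarith)
  have hcy : 0 < Real.cos y := Real.cos_pos_of_mem_Ioo ⟨by linarith, by linarith⟩
  have hle : Real.sin x * Real.cos y ≤ Real.sin x :=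
    mul_le_of_le_one_right hsx.le (Real.cos_le_one y)
  have hsin : Real.sin (Real.arcsin (Real.sin x * Real.cos y)) = Real.sin x * Real.cos y :=
    Real.sin_arcsin (by linarith [mul_pos hsx hcy]) (hle.trans (Real.sin_le_one x))
  have ha0 : 0 ≤ Real.arcsin (Real.sin x * Real.cos y) :=
    Real.arcsin_nonneg.2 (mul_pos hsx hcy).le
  have hax : Real.arcsin (Real.sin x * Real.cos y) ≤ x := by
    simpa [Real.arcsin_sin (by linarith : -(π / 2) ≤ x) (by linarith)] using
      Real.monotone_arcsin hle
  have hlow := sin_sub_sin_le_sub hax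
  have hup := cos_mul_sub_le_sin_sub_sin ha0 hax (by linarith)
  rw [hsin] at hlow hup
  set h := x - Real.arcsin (Real.sin x * Real.cos y) with hh
  have hnonneg : 0 ≤ h := sub_nonneg.2 hax
  have hxy : 0 < x * y ^ 2 := by positivity
  have hx2 : x ^ 2 ≤ 1 := pow_le_one₀ hx.le hx1
  have hy2 : y ^ 2 ≤ 1 := pow_le_one₀ hy.le hy1
  have hcos : 1 - Real.cos y ≤ y ^ 2 / 2 := by linarith [Real.one_sub_sq_div_two_le_cos (x := y)]
  have hcos' : y ^ 2 / 2 - y ^ 4 * (5 / 96) ≤ 1 - Real.cos y := by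
    have := (abs_le.1 (Real.cos_bound (x := y) (by rwa [abs_of_pos hy]))).2
    rw [abs_of_pos hy] at this
    linarith
  have upper : h ≤ (1 / 2 + x ^ 2 / 2) * (x * y ^ 2) := by
    have h1 : (1 - x ^ 2 / 2) * h ≤ x * (y ^ 2 / 2) := calc
      _ ≤ Real.cos x * h :=
        mul_le_mul_of_nonneg_right Real.one_sub_sq_div_two_le_cos hnonneg
      _ ≤ Real.sin x * (1 - Real.cos y) := by linarith
      _ ≤ x * (y ^ 2 / 2) :=
        mul_le_mul (Real.sin_le hx.le) hcos (by linarith [Real.cos_le_one y]) hx.le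
    have h2 : (1 + x ^ 2) * ((1 - x ^ 2 / 2) * h) ≤ (1 + x ^ 2) * (x * (y ^ 2 / 2)) :=
      mul_le_mul_of_nonneg_left h1 (by positivity)
    have h3 : 0 ≤ x ^ 2 * (1 - x ^ 2) * h :=
      mul_nonneg (mul_nonneg (sq_nonneg x) (by linarith)) hnonneg
    linarith
  have lower : (1 / 2 - x ^ 2 / 12 - y ^ 2 * (5 / 96)) * (x * y ^ 2) ≤ h := by
    have h1 : (x - x ^ 3 / 6) * (y ^ 2 / 2 - y ^ 4 * (5 / 96)) ≤ h := calc
      _ ≤ Real.sin x * (1 - Real.cos y) :=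
        mul_le_mul (Real.sin_gt_sub_cube hx).le hcos'
          (by nlinarith [sq_nonneg y]) hsx.le
      _ ≤ h := by linarith
    have h2 : 0 ≤ x ^ 3 * y ^ 4 := by positivity
    linarith
  rw [abs_le]
  constructor
  · have : 1 / 2 - x ^ 2 / 12 - y ^ 2 * (5 / 96) ≤ h / (x * y ^ 2) := (le_div_iff₀ hxy).2 lower
    linarith [sq_nonneg x, sq_nonneg y]
  · have : h / (x * y ^ 2) ≤ 1 / 2 + x ^ 2 / 2 := (div_le_iff₀ hxy).2 upper
    linarith [sq_nonneg y]

/-- The function g(x,y) := (x − arcsin((sin x)(cos y)))/(x·y²) − 1/2 is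
o(√(x²+y²)) as (x,y) → (0,0) in the open quadrant: for every c > 0 there is
δ > 0 such that for all x, y ∈ (0,δ),
|(x − arcsin((sin x)(cos y)))/(x·y²) − 1/2| ≤ c·√(x² + y²).
In particular, (x − arcsin((sin x)(cos y)))/(x·y²) → 1/2 as (x,y) → (0,0)
with x, y > 0. -/
theorem stmt_6 :
    (∀ c : ℝ, 0 < c → ∃ δ : ℝ, 0 < δ ∧ ∀ x y : ℝ,
      x ∈ Set.Ioo 0 δ → y ∈ Set.Ioo 0 δ →
        |(x - Real.arcsin (Real.sin x * Real.cos y)) / (x * y ^ 2) - 1/2|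
          ≤ c * Real.sqrt (x ^ 2 + y ^ 2)) ∧
    Tendsto
      (fun p : ℝ × ℝ =>
        (p.1 - Real.arcsin (Real.sin p.1 * Real.cos p.2)) / (p.1 * p.2 ^ 2))
      (nhdsWithin (0, 0) (Set.Ioi (0:ℝ) ×ˢ Set.Ioi (0:ℝ))) (nhds (1/2)) := by
  constructor
  · intro c hc
    refine ⟨min 1 c, lt_min one_pos hc, fun x y hx hy => ?_⟩
    obtain ⟨hx1, hxc⟩ := lt_min_iff.1 hx.2
    obtain ⟨hy1, hyc⟩ := lt_min_iff.1 hy.2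
    refine (abs_sub_arcsin_sin_mul_cos_div_sub_half_le hx.1 hx1.le hy.1 hy1.le).trans ?_
    have hsqrt : √(x ^ 2 + y ^ 2) ≤ 2 * c :=
      Real.sqrt_le_iff.2 ⟨by linarith, by nlinarith [hx.1, hy.1]⟩
    nlinarith [Real.sq_sqrt (show 0 ≤ x ^ 2 + y ^ 2 by positivity),
      Real.sqrt_nonneg (x ^ 2 + y ^ 2)]
  · rw [tendsto_iff_norm_sub_tendsto_zero]
    have hlim : Tendsto (fun p : ℝ × ℝ => (p.1 ^ 2 + p.2 ^ 2) / 2)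
        (nhdsWithin (0, 0) (Set.Ioi (0:ℝ) ×ˢ Set.Ioi (0:ℝ))) (nhds 0) := by
      have hcont : Continuous fun p : ℝ × ℝ => (p.1 ^ 2 + p.2 ^ 2) / 2 := by fun_prop
      simpa using (hcont.tendsto (0, 0)).mono_left nhdsWithin_le_nhds
    refine squeeze_zero' (Eventually.of_forall fun _ => norm_nonneg _) ?_ hlim
    have hnear : ∀ᶠ p : ℝ × ℝ in nhds (0, 0), p.1 < 1 ∧ p.2 < 1 :=
      (continuous_fst.tendsto (0, 0) |>.eventually_lt_const one_pos).and
        (continuous_snd.tendsto (0, 0) |>.eventually_lt_const one_pos)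
    filter_upwards [self_mem_nhdsWithin, nhdsWithin_le_nhds hnear] with p hp hlt
    exact abs_sub_arcsin_sin_mul_cos_div_sub_half_le hp.1 hlt.1.le hp.2 hlt.2.le
end

section
/- Fix y₀ ∈ (0,π). If y₀ ∈ (0,π/2), then the function x ↦ (x − arcsin((sin x)(cos y₀)))/x is strictly increasing on the interval (0,π/2); if y₀ ∈ (π/2,π), then this function is strictly decreasing on (0,π/2); and if y₀ = π/2 it is constant equal to 1 there. -/
open Real

theorem hasDerivAt_arcsin_sin_mul {c : ℝ} (h0 : 0 < c) (h1 : c < 1) (x : ℝ) :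
    HasDerivAt (fun x => arcsin (sin x * c)) (cos x * c / √(1 - (sin x * c) ^ 2)) x := by
  have hlt : |sin x * c| < 1 := by
    rw [abs_mul, abs_of_pos h0]
    nlinarith [abs_sin_le_one x]
  obtain ⟨hl, hr⟩ := abs_lt.mp hlt
  have h := (hasDerivAt_arcsin hl.ne' hr.ne).comp x ((hasDerivAt_sin x).mul_const c)
  exact h.congr_deriv (by ring)

theorem strictConcaveOn_arcsin_sin_mul {c : ℝ} (h0 : 0 < c) (h1 : c < 1) :
    StrictConcaveOn ℝ (Set.Icc 0 (π / 2)) (fun x => arcsin (sin x * c)) := by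
  refine StrictAntiOn.strictConcaveOn_of_deriv (convex_Icc _ _) (by fun_prop) ?_
  rw [interior_Icc]
  intro a ha b hb hab
  rw [(hasDerivAt_arcsin_sin_mul h0 h1 a).deriv, (hasDerivAt_arcsin_sin_mul h0 h1 b).deriv]
  have hsin : sin a < sin b :=
    sin_lt_sin_of_lt_of_le_pi_div_two (by linarith [ha.1, pi_pos]) hb.2.le hab
  have hsa : 0 < sin a := sin_pos_of_pos_of_lt_pi ha.1 (by linarith [ha.2, pi_pos])
  have hca : 0 < cos a := cos_pos_of_mem_Ioo ⟨by linarith [ha.1, pi_pos], ha.2⟩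
  have hc2 : c ^ 2 < 1 := by nlinarith
  have hpos (x : ℝ) : 0 < 1 - (sin x * c) ^ 2 := by
    nlinarith [sin_sq_le_one x, sq_nonneg (sin x), sq_nonneg c]
  have hsq : sin a ^ 2 < sin b ^ 2 := by gcongr
  rw [div_lt_div_iff₀ (sqrt_pos.mpr (hpos b)) (sqrt_pos.mpr (hpos a))]
  refine lt_of_pow_lt_pow_left₀ 2 (by positivity) ?_
  rw [mul_pow (cos b * c), mul_pow (cos a * c), sq_sqrt (hpos _).le, sq_sqrt (hpos _).le,
    mul_pow (cos b), mul_pow (cos a), cos_sq', cos_sq']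
  have key := mul_pos (pow_pos h0 2) (mul_pos (sub_pos.mpr hsq) (sub_pos.mpr hc2))
  linear_combination key

theorem strictAntiOn_arcsin_sin_mul_div {c : ℝ} (h0 : 0 < c) (h1 : c < 1) :
    StrictAntiOn (fun x => arcsin (sin x * c) / x) (Set.Ioo 0 (π / 2)) := by
  intro a ha b hb hab
  have ha0 : 0 < a := ha.1
  have hb0 : 0 < b := hb.1
  have h := (strictConcaveOn_arcsin_sin_mul h0 h1).2
    (Set.left_mem_Icc.mpr (by positivity)) (Set.Ioo_subset_Icc_self hb) hb0.ne
    (sub_pos.mpr ((div_lt_one hb0).mpr hab)) (div_pos ha0 hb0) (by ring)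
  simp only [smul_eq_mul, mul_zero, sin_zero, zero_mul, arcsin_zero, zero_add,
    div_mul_cancel₀ a hb0.ne'] at h
  change arcsin (sin b * c) / b < arcsin (sin a * c) / a
  rw [lt_div_iff₀ ha0]
  calc _ = a / b * arcsin (sin b * c) := by ring
    _ < _ := h

/-- Fix y₀ ∈ (0,π). If y₀ ∈ (0,π/2), then x ↦ (x − arcsin((sin x)(cos y₀)))/x
is strictly increasing on (0,π/2); if y₀ ∈ (π/2,π) it is strictly decreasing
there; and if y₀ = π/2 it is constant equal to 1 there. -/
theorem stmt_7 (y₀ : ℝ) (hy₀ : y₀ ∈ Set.Ioo 0 π) :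
    (y₀ ∈ Set.Ioo 0 (π/2) →
      StrictMonoOn (fun x : ℝ => (x - Real.arcsin (Real.sin x * Real.cos y₀)) / x)
        (Set.Ioo 0 (π/2))) ∧
    (y₀ ∈ Set.Ioo (π/2) π →
      StrictAntiOn (fun x : ℝ => (x - Real.arcsin (Real.sin x * Real.cos y₀)) / x)
        (Set.Ioo 0 (π/2))) ∧
    (y₀ = π/2 → ∀ x ∈ Set.Ioo 0 (π/2),
      (x - Real.arcsin (Real.sin x * Real.cos y₀)) / x = 1) := by
  refine ⟨fun hy a ha b hb hab => ?_, fun hy a ha b hb hab => ?_, fun hy x hx => ?_⟩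
  · have h0 : 0 < cos y₀ := cos_pos_of_mem_Ioo ⟨by linarith [hy.1, pi_pos], hy.2⟩
    have h1 : cos y₀ < 1 := by
      simpa using cos_lt_cos_of_nonneg_of_le_pi le_rfl hy₀.2.le hy₀.1
    have h := strictAntiOn_arcsin_sin_mul_div h0 h1 ha hb hab
    simp only [sub_div, div_self ha.1.ne', div_self hb.1.ne'] at h ⊢
    linarith
  · have h0 : 0 < -cos y₀ :=
      neg_pos.mpr (cos_neg_of_pi_div_two_lt_of_lt hy.1 (by linarith [hy.2, pi_pos]))
    have h1 : -cos y₀ < 1 := by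
      have := cos_lt_cos_of_nonneg_of_le_pi hy₀.1.le le_rfl hy₀.2
      rw [cos_pi] at this
      linarith
    have h := strictAntiOn_arcsin_sin_mul_div h0 h1 ha hb hab
    simp only [mul_neg, arcsin_neg, neg_div, sub_div, div_self ha.1.ne',
      div_self hb.1.ne'] at h ⊢
    linarith
  · simp [hy, div_self hx.1.ne']
end

section
/- For all s, t ∈ (0,1) one has t·(arcsin s)·√(1−s²) < (arcsin(st))·√(1−s²t²). -/
open Real

/-- Strict concavity of `sin` on `[0, π]`, in the form that `sin x / x` is strictly decreasing. -/
lemma mul_sin_lt_mul_sin {v u : ℝ} (hv : 0 < v) (hvu : v < u) (hu : u ≤ π) :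
    v * sin u < u * sin v := by
  have hu0 : 0 < u := hv.trans hvu
  have h := strictConcaveOn_sin_Icc.2 (Set.left_mem_Icc.2 pi_pos.le) ⟨hu0.le, hu⟩ hu0.ne
    (sub_pos.2 ((div_lt_one hu0).2 hvu)) (div_pos hv hu0) (sub_add_cancel 1 (v / u))
  simp only [smul_eq_mul, sin_zero, mul_zero, zero_add, div_mul_cancel₀ _ hu0.ne'] at h
  rwa [div_mul_eq_mul_div, div_lt_iff₀ hu0, mul_comm (sin v)] at h

/-- The function `x * cot x` is strictly decreasing on `(0, π / 2]`. -/
lemma mul_sin_mul_cos_lt {a b : ℝ} (hb : 0 < b) (hba : b < a) (ha : a ≤ π / 2) :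
    a * (sin b * cos a) < b * (cos b * sin a) := by
  have h := mul_sin_lt_mul_sin (v := a - b) (u := a + b) (by linarith) (by linarith) (by linarith)
  rw [sin_add, sin_sub] at h
  linarith

/-- For all s, t ∈ (0,1) one has t·(arcsin s)·√(1−s²) < (arcsin(st))·√(1−s²t²). -/
theorem stmt_8 (s t : ℝ) (hs : s ∈ Set.Ioo (0:ℝ) 1) (ht : t ∈ Set.Ioo (0:ℝ) 1) :
    t * Real.arcsin s * Real.sqrt (1 - s ^ 2) <
      Real.arcsin (s * t) * Real.sqrt (1 - s ^ 2 * t ^ 2) := by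
  obtain ⟨hs0, hs1⟩ := hs
  obtain ⟨ht0, ht1⟩ := ht
  have hst0 : 0 < s * t := mul_pos hs0 ht0
  have hsts : s * t < s := mul_lt_of_lt_one_right hs0 ht1
  have h := mul_sin_mul_cos_lt (arcsin_pos.2 hst0)
    (arcsin_lt_arcsin (by linarith) hsts hs1.le) (arcsin_le_pi_div_two s)
  rw [sin_arcsin (by linarith) (by linarith), sin_arcsin (by linarith) hs1.le,
    cos_arcsin, cos_arcsin, mul_pow] at h
  refine lt_of_mul_lt_mul_left ?_ hs0.le
  linarith
end

section
/- The function r(z) = (arcsin z)·√(1−z²) is strictly concave on the interval (0,1); equivalently, its second derivative is strictly negative at every z ∈ (0,1). -/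
open Real

theorem hasDerivAt_sqrt_one_sub_sq {z : ℝ} (hz : z ∈ Set.Ioo (-1 : ℝ) 1) :
    HasDerivAt (fun z : ℝ => √(1 - z ^ 2)) (-z / √(1 - z ^ 2)) z := by
  have h : 0 < 1 - z ^ 2 := by nlinarith [hz.1, hz.2]
  have hs := (Real.sqrt_pos.2 h).ne'
  refine (((hasDerivAt_pow 2 z).const_sub 1).sqrt h.ne').congr_deriv ?_
  push_cast
  field_simp

theorem hasDerivAt_arcsin_mul_sqrt {z : ℝ} (hz : z ∈ Set.Ioo (-1 : ℝ) 1) :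
    HasDerivAt (fun z : ℝ => arcsin z * √(1 - z ^ 2))
      (1 - z * arcsin z / √(1 - z ^ 2)) z := by
  have h : 0 < 1 - z ^ 2 := by nlinarith [hz.1, hz.2]
  have hs := (Real.sqrt_pos.2 h).ne'
  refine ((hasDerivAt_arcsin hz.1.ne' hz.2.ne).mul
    (hasDerivAt_sqrt_one_sub_sq hz)).congr_deriv ?_
  field_simp
  ring

theorem deriv_deriv_arcsin_mul_sqrt {z : ℝ} (hz : z ∈ Set.Ioo (-1 : ℝ) 1) :
    deriv (deriv (fun z : ℝ => arcsin z * √(1 - z ^ 2))) z =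
      -(arcsin z / √(1 - z ^ 2) + z / √(1 - z ^ 2) ^ 2
        + z ^ 2 * arcsin z / √(1 - z ^ 2) ^ 3) := by
  have h : 0 < 1 - z ^ 2 := by nlinarith [hz.1, hz.2]
  have hs := (Real.sqrt_pos.2 h).ne'
  have heq : deriv (fun z : ℝ => arcsin z * √(1 - z ^ 2)) =ᶠ[nhds z]
      fun z => 1 - z * arcsin z / √(1 - z ^ 2) := by
    filter_upwards [isOpen_Ioo.mem_nhds hz] with y hy
    exact (hasDerivAt_arcsin_mul_sqrt hy).deriv
  rw [heq.deriv_eq]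
  refine (((((hasDerivAt_id z).mul (hasDerivAt_arcsin hz.1.ne' hz.2.ne)).div
    (hasDerivAt_sqrt_one_sub_sq hz) hs).const_sub 1).congr_deriv ?_).deriv
  simp only [Pi.mul_apply, id]
  field_simp
  ring

theorem deriv_deriv_arcsin_mul_sqrt_neg {z : ℝ} (hz : z ∈ Set.Ioo (0 : ℝ) 1) :
    deriv (deriv (fun z : ℝ => arcsin z * √(1 - z ^ 2))) z < 0 := by
  have h0 : 0 < z := hz.1
  have h : 0 < √(1 - z ^ 2) := Real.sqrt_pos.2 (by nlinarith [hz.1, hz.2])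
  have ha : 0 < arcsin z := arcsin_pos.2 h0
  rw [deriv_deriv_arcsin_mul_sqrt ⟨by linarith, hz.2⟩, neg_lt_zero]
  positivity

/-- The function r(z) = (arcsin z)·√(1−z²) is strictly concave on (0,1);
equivalently, its second derivative is strictly negative at every z ∈ (0,1). -/
theorem stmt_9 :
    StrictConcaveOn ℝ (Set.Ioo (0:ℝ) 1)
      (fun z : ℝ => Real.arcsin z * Real.sqrt (1 - z ^ 2)) ∧
    ∀ z ∈ Set.Ioo (0:ℝ) 1,
      deriv (deriv (fun z : ℝ => Real.arcsin z * Real.sqrt (1 - z ^ 2))) z < 0 := by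
  refine ⟨strictConcaveOn_of_deriv2_neg' (convex_Ioo 0 1) ?_
    fun z hz => deriv_deriv_arcsin_mul_sqrt_neg hz, fun z hz => deriv_deriv_arcsin_mul_sqrt_neg hz⟩
  exact (continuous_arcsin.mul (by fun_prop)).continuousOn
end

section
/- For all x ∈ (0,π/2) and all y ∈ (0,π) one has π − x + arcsin((sin x)(cos y)) ≥ (1/3)·((π/2 − x) + (π − y)). -/
open Real

/-- For all x ∈ (0,π/2) and all y ∈ (0,π) one has
π − x + arcsin((sin x)(cos y)) ≥ (1/3)·((π/2 − x) + (π − y)). -/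
theorem stmt_10 (x y : ℝ) (hx : x ∈ Set.Ioo 0 (π/2)) (hy : y ∈ Set.Ioo 0 π) :
    π - x + Real.arcsin (Real.sin x * Real.cos y) ≥
      (1/3) * ((π/2 - x) + (π - y)) := by
  obtain ⟨hx0, hx1⟩ := hx
  obtain ⟨hy0, hy1⟩ := hy
  have hsin : 0 ≤ sin x := sin_nonneg_of_nonneg_of_le_pi hx0.le (by linarith)
  rcases le_total y (π / 2) with h | h
  · have hcos : 0 ≤ cos y := cos_nonneg_of_neg_pi_div_two_le_of_le (by linarith) h
    have harc : 0 ≤ arcsin (sin x * cos y) := arcsin_nonneg.2 (mul_nonneg hsin hcos)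
    linarith
  · have hcos : cos y ≤ 0 := cos_nonpos_of_pi_div_two_le_of_le h (by linarith)
    have harc : arcsin (sin (π / 2 - y)) ≤ arcsin (sin x * cos y) := by
      rw [sin_pi_div_two_sub]
      exact monotone_arcsin (le_mul_of_le_one_left hcos (sin_le_one x))
    rw [arcsin_sin (by linarith) (by linarith)] at harc
    linarith
end

section
/- For all x ∈ (0,π/2) and all y ∈ (0,π) one has x + (1/5)·√(5(x² + y²) − x²y²) ≥ (x + y)/3. -/
open Real

/-- For all x ∈ (0,π/2) and all y ∈ (0,π) one has
x + (1/5)·√(5(x² + y²) − x²y²) ≥ (x + y)/3. -/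
theorem stmt_12 (x y : ℝ) (hx : x ∈ Set.Ioo 0 (π/2)) (hy : y ∈ Set.Ioo 0 π) :
    x + (1/5) * Real.sqrt (5 * (x ^ 2 + y ^ 2) - x ^ 2 * y ^ 2) ≥ (x + y) / 3 := by
  obtain ⟨hx0, -⟩ := hx
  obtain ⟨hy0, hyπ⟩ := hy
  suffices h : 5 * (y - 2 * x) / 3 ≤ √(5 * (x ^ 2 + y ^ 2) - x ^ 2 * y ^ 2) by linarith
  rcases le_total y (2 * x) with hyx | hxy
  · exact le_trans (by linarith) (Real.sqrt_nonneg _)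
  · apply Real.le_sqrt_of_sq_le
    have hy2 : y ^ 2 ≤ 10 := by nlinarith [Real.pi_lt_d2]
    have hxx : 2 * x ^ 2 ≤ x * y := by nlinarith
    have hxy2 : x ^ 2 * y ^ 2 ≤ x ^ 2 * 10 := by gcongr
    nlinarith [sq_nonneg y, mul_pos hx0 hy0]
end

section
/- Let d ≥ 1 be an integer and let α > 0 and ε > 0 be real numbers. Define G(α,γ) = ∫_0^{αγ} s^{d−1} (∫_0^ε t^{d−1} e^{−st} dt) ds. Then lim_{γ→∞} G(α,γ)/log γ = (d−1)!. -/
open Real Filter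

/-- If `s * f s → L` at infinity, then `∫₀ˣ f` grows like `L * log x`. -/
theorem tendsto_integral_div_log {f : ℝ → ℝ} {L : ℝ} (hf : Continuous f)
    (h : Tendsto (fun s => s * f s) atTop (nhds L)) :
    Tendsto (fun x => (∫ s in (0:ℝ)..x, f s) / Real.log x) atTop (nhds L) := by
  rw [Metric.tendsto_atTop]
  intro δ hδ
  obtain ⟨X₀, hX₀⟩ := Metric.tendsto_atTop.1 h (δ / 2) (half_pos hδ)
  set X := max X₀ 1
  have hX1 : 1 ≤ X := le_max_right _ _
  have hXpos : 0 < X := by linarith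
  set C := |(∫ s in (0:ℝ)..X, f s) - L * Real.log X|
  obtain ⟨Y, hY⟩ := eventually_atTop.1
    (Real.tendsto_log_atTop.eventually_gt_atTop (2 * C / δ))
  refine ⟨max (X + 1) Y, fun x hx => ?_⟩
  have hXx : X + 1 ≤ x := le_trans (le_max_left _ _) hx
  have hlog : 0 < Real.log x := Real.log_pos (by linarith)
  have hC : 2 * C < Real.log x * δ :=
    (div_lt_iff₀ hδ).1 (hY x (le_trans (le_max_right _ _) hx))
  have hinv : IntervalIntegrable (fun s : ℝ => s⁻¹) MeasureTheory.volume X x :=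
    intervalIntegrable_inv_iff.2 (Or.inr (by
      rw [Set.uIcc_of_le (by linarith)]
      exact fun hmem => by linarith [hmem.1]))
  have hint : ∫ s in X..x, s⁻¹ = Real.log x - Real.log X := by
    rw [integral_inv_of_pos hXpos (by linarith), Real.log_div (by linarith) hXpos.ne']
  have hsub : ∫ s in X..x, (f s - L * s⁻¹) =
      (∫ s in X..x, f s) - L * (Real.log x - Real.log X) := by
    rw [intervalIntegral.integral_sub (hf.intervalIntegrable _ _) (hinv.const_mul L),
      intervalIntegral.integral_const_mul, hint]
  have hbound : |∫ s in X..x, (f s - L * s⁻¹)| ≤ δ / 2 * (Real.log x - Real.log X) := by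
    rw [← hint, ← intervalIntegral.integral_const_mul, ← Real.norm_eq_abs]
    refine intervalIntegral.norm_integral_le_of_norm_le (by linarith)
      (Eventually.of_forall fun s hs => ?_) (hinv.const_mul _)
    have hs0 : 0 < s := hXpos.trans hs.1
    have hd := hX₀ s ((le_max_left _ _).trans hs.1.le)
    rw [Real.dist_eq] at hd
    have heq : f s - L * s⁻¹ = (s * f s - L) * s⁻¹ := by field_simp
    rw [heq, norm_mul, Real.norm_eq_abs, Real.norm_of_nonneg (inv_pos.2 hs0).le]
    gcongr
  have hadd := intervalIntegral.integral_add_adjacent_intervals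
    (hf.intervalIntegrable (μ := MeasureTheory.volume) 0 X) (hf.intervalIntegrable X x)
  have hlogX : 0 ≤ Real.log X := Real.log_nonneg hX1
  have hmain : |(∫ s in (0:ℝ)..x, f s) - L * Real.log x| < δ * Real.log x := by
    have htri := abs_add_le ((∫ s in (0:ℝ)..X, f s) - L * Real.log X)
      (∫ s in X..x, (f s - L * s⁻¹))
    have heq : (∫ s in (0:ℝ)..x, f s) - L * Real.log x =
        ((∫ s in (0:ℝ)..X, f s) - L * Real.log X) + ∫ s in X..x, (f s - L * s⁻¹) := by
      rw [hsub, ← hadd]; ring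
    rw [heq]
    have := mul_nonneg hδ.le hlogX
    change _ ≤ C + _ at htri
    linarith
  have heq : (∫ s in (0:ℝ)..x, f s) / Real.log x - L =
      ((∫ s in (0:ℝ)..x, f s) - L * Real.log x) / Real.log x := by
    field_simp
  rw [Real.dist_eq, heq, abs_div, abs_of_pos hlog, div_lt_iff₀ hlog]
  exact hmain

theorem tendsto_integral_pow_mul_exp_neg (n : ℕ) :
    Tendsto (fun x : ℝ => ∫ u in (0:ℝ)..x, u ^ n * Real.exp (-u)) atTop
      (nhds (n.factorial : ℝ)) := by
  have hEq : Set.EqOn (fun u : ℝ => Real.exp (-u) * u ^ ((n + 1 : ℝ) - 1))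
      (fun u => u ^ n * Real.exp (-u)) (Set.Ioi 0) := fun u _ => by
    simp [mul_comm]
  have hpos : (0:ℝ) < n + 1 := by positivity
  have hint := (Real.GammaIntegral_convergent hpos).congr_fun hEq measurableSet_Ioi
  rw [← Real.Gamma_nat_eq_factorial, Real.Gamma_eq_integral hpos,
    MeasureTheory.setIntegral_congr_fun measurableSet_Ioi hEq]
  exact MeasureTheory.intervalIntegral_tendsto_integral_Ioi 0 hint tendsto_id

theorem mul_pow_mul_integral_pow_mul_exp_neg_mul (n : ℕ) (ε s : ℝ) :
    s * (s ^ n * ∫ t in (0:ℝ)..ε, t ^ n * Real.exp (-(s * t))) =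
      ∫ u in (0:ℝ)..(s * ε), u ^ n * Real.exp (-u) := by
  have h := intervalIntegral.mul_integral_comp_mul_left (a := 0) (b := ε)
    (f := fun u : ℝ => u ^ n * Real.exp (-u)) s
  rw [mul_zero] at h
  rw [← h, ← intervalIntegral.integral_const_mul]
  simp only [mul_pow, mul_assoc]

/-- Let d ≥ 1, α > 0, ε > 0 and set
G(α,γ) = ∫_0^{αγ} s^{d−1} (∫_0^ε t^{d−1} e^{−st} dt) ds. Then
G(α,γ)/log γ → (d−1)! as γ → ∞. -/
theorem stmt_13 (d : ℕ) (hd : 1 ≤ d) (α ε : ℝ) (hα : 0 < α) (hε : 0 < ε) :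
    Tendsto
      (fun γ : ℝ =>
        (∫ s in (0:ℝ)..(α * γ),
          s ^ (d - 1) * ∫ t in (0:ℝ)..ε, t ^ (d - 1) * Real.exp (-(s * t))) /
            Real.log γ)
      atTop (nhds ((Nat.factorial (d - 1) : ℝ))) := by
  have hcont : Continuous fun s : ℝ =>
      s ^ (d - 1) * ∫ t in (0:ℝ)..ε, t ^ (d - 1) * Real.exp (-(s * t)) :=
    (continuous_pow _).mul
      (intervalIntegral.continuous_parametric_intervalIntegral_of_continuous' (by fun_prop) _ _)
  have hlim := (tendsto_integral_pow_mul_exp_neg (d - 1)).comp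
    (tendsto_id.atTop_mul_const hε)
  have hG := (tendsto_integral_div_log hcont (hlim.congr fun s =>
    (mul_pow_mul_integral_pow_mul_exp_neg_mul (d - 1) ε s).symm)).comp
    (tendsto_id.const_mul_atTop hα)
  have hratio : Tendsto (fun γ : ℝ => Real.log α / Real.log γ + 1) atTop (nhds 1) := by
    simpa using (Real.tendsto_log_atTop.const_div_atTop (Real.log α)).add_const 1
  have hprod := hG.mul hratio
  rw [mul_one] at hprod
  refine hprod.congr' ?_
  filter_upwards [eventually_gt_atTop 1, (Real.tendsto_log_atTop.comp
    (tendsto_id.const_mul_atTop hα)).eventually_ne_atTop 0] with γ hγ hne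
  have hlog : Real.log γ ≠ 0 := (Real.log_pos hγ).ne'
  simp only [Function.comp_apply, id_eq] at hne ⊢
  have hmul : Real.log α / Real.log γ + 1 = Real.log (α * γ) / Real.log γ := by
    rw [Real.log_mul hα.ne' (by linarith)]
    field_simp
  rw [hmul, div_mul_div_cancel₀ hne]
end

section
/- Let d ≥ 1 be an integer and let α > 0 and ε > 0 be real numbers with α·ε ≤ 1. Define, for each natural number n > d, H(α,n) = ∫_0^{nα} ∫_0^ε s^{d−1} t^{d−1} (1 − st/n)^{n−d} dt ds. Then lim_{n→∞} H(α,n)/log n = (d−1)!. -/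
open Real Filter

/-- The inner integral, after the substitution `v = s * t`. -/
theorem mul_integral_pow_mul_one_sub_pow (k m : ℕ) (x s ε : ℝ) :
    s * ∫ t in (0:ℝ)..ε, s ^ k * t ^ k * (1 - s * t / x) ^ m =
      ∫ v in (0:ℝ)..(s * ε), v ^ k * (1 - v / x) ^ m := by
  have h := intervalIntegral.smul_integral_comp_mul_left (a := 0) (b := ε)
    (fun v : ℝ => v ^ k * (1 - v / x) ^ m) s
  simpa [mul_pow] using h

theorem continuous_inner_integral (k m : ℕ) (x ε : ℝ) :
    Continuous fun s : ℝ => ∫ t in (0:ℝ)..ε, s ^ k * t ^ k * (1 - s * t / x) ^ m := by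
  apply intervalIntegral.continuous_parametric_intervalIntegral_of_continuous'
  simp only [div_eq_mul_inv]
  fun_prop

theorem continuous_pow_mul_one_sub_div_pow (k m : ℕ) (x : ℝ) :
    Continuous fun v : ℝ => v ^ k * (1 - v / x) ^ m := by
  simp only [div_eq_mul_inv]
  fun_prop

theorem integrableOn_pow_mul_exp_neg_mul (k : ℕ) {r : ℝ} (hr : 0 < r) :
    MeasureTheory.IntegrableOn (fun v : ℝ => v ^ k * exp (-(r * v))) (Set.Ioi 0) := by
  have h := integrableOn_rpow_mul_exp_neg_mul_rpow (s := k) (p := 1) (b := r)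
    (by have := k.cast_nonneg (α := ℝ); linarith) one_pos hr
  simpa [rpow_natCast] using h

theorem integral_Ioi_pow_mul_exp_neg_mul (k : ℕ) {r : ℝ} (hr : 0 < r) :
    ∫ v in Set.Ioi (0:ℝ), v ^ k * exp (-(r * v)) = (1 / r) ^ (k + 1) * (Nat.factorial k : ℝ) := by
  have h := integral_rpow_mul_exp_neg_mul_Ioi (a := (k : ℝ) + 1) (r := r) (by positivity) hr
  rw [Gamma_nat_eq_factorial] at h
  rw [← rpow_natCast]
  push_cast
  rw [← h]
  simp [rpow_natCast]

theorem one_sub_div_pow_mem_Icc {x v : ℝ} (m : ℕ) (hx : 0 < x) (hv : v ∈ Set.Icc 0 x) :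
    (1 - v / x) ^ m ∈ Set.Icc 0 1 := by
  have h1 : v / x ≤ 1 := (div_le_one hx).2 hv.2
  have h2 : 0 ≤ v / x := div_nonneg hv.1 hx.le
  exact ⟨pow_nonneg (by linarith) m, pow_le_one₀ (by linarith) (by linarith)⟩

theorem integral_pow_mul_one_sub_pow_le (k : ℕ) {m : ℕ} (hm : 0 < m) {x u : ℝ} (hx : 0 < x)
    (hu : u ∈ Set.Icc 0 x) :
    ∫ v in (0:ℝ)..u, v ^ k * (1 - v / x) ^ m ≤ (x / m) ^ (k + 1) * (Nat.factorial k : ℝ) := by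
  have hr : 0 < m / x := by positivity
  have hi := integrableOn_pow_mul_exp_neg_mul k hr
  calc ∫ v in (0:ℝ)..u, v ^ k * (1 - v / x) ^ m
      ≤ ∫ v in (0:ℝ)..u, v ^ k * exp (-(m / x * v)) := by
        apply intervalIntegral.integral_mono_on hu.1
          ((continuous_pow_mul_one_sub_div_pow k m x).intervalIntegrable _ _)
          (Continuous.intervalIntegrable (by fun_prop) _ _)
        intro v hv
        have h1 : v / x ≤ 1 := (div_le_one hx).2 (hv.2.trans hu.2)
        have h2 : 1 - v / x ≤ exp (-(v / x)) := one_sub_le_exp_neg _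
        have h3 : exp (-(m / x * v)) = exp (-(v / x)) ^ m := by
          rw [← exp_nat_mul]; congr 1; ring
        rw [h3]
        have := hv.1
        gcongr
    _ = ∫ v in Set.Ioc 0 u, v ^ k * exp (-(m / x * v)) :=
        intervalIntegral.integral_of_le hu.1
    _ ≤ ∫ v in Set.Ioi (0:ℝ), v ^ k * exp (-(m / x * v)) := by
        apply MeasureTheory.setIntegral_mono_set hi
        · filter_upwards [MeasureTheory.ae_restrict_mem measurableSet_Ioi] with v hv
          have : (0:ℝ) < v := hv
          simp only [Pi.zero_apply]
          positivity
        · exact Set.Ioc_subset_Ioi_self.eventuallyLE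
    _ = (x / m) ^ (k + 1) * (Nat.factorial k : ℝ) := by
        rw [integral_Ioi_pow_mul_exp_neg_mul k hr, one_div_div]

theorem tendsto_one_sub_div_pow_sub (d : ℕ) (v : ℝ) :
    Tendsto (fun n : ℕ => (1 - v / n) ^ (n - d)) atTop (nhds (exp (-v))) := by
  have h0 : Tendsto (fun n : ℕ => 1 - v / n) atTop (nhds 1) := by
    simpa using (tendsto_const_div_atTop_nhds_zero_nat v).const_sub 1
  have h1 : Tendsto (fun n : ℕ => (1 - v / n) ^ n) atTop (nhds (exp (-v))) := by
    simpa [sub_eq_add_neg, neg_div] using tendsto_one_add_div_pow_exp (-v)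
  have h2 := h1.div (h0.pow d) (by simp)
  rw [one_pow, div_one] at h2
  refine h2.congr' ?_
  filter_upwards [h0.eventually_ne one_ne_zero, eventually_ge_atTop d] with n hn hd
  rw [Pi.div_apply, pow_sub₀ _ hn hd, div_eq_mul_inv]

theorem tendsto_integral_pow_mul_one_sub_pow (k d : ℕ) {K : ℝ} (hK : 0 ≤ K) :
    Tendsto (fun n : ℕ => ∫ v in (0:ℝ)..K, v ^ k * (1 - v / n) ^ (n - d)) atTop
      (nhds (∫ v in (0:ℝ)..K, v ^ k * exp (-v))) := by
  apply intervalIntegral.tendsto_integral_filter_of_dominated_convergence (fun v => v ^ k)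
  · exact Eventually.of_forall fun n =>
      (continuous_pow_mul_one_sub_div_pow k (n - d) n).aestronglyMeasurable
  · filter_upwards [tendsto_natCast_atTop_atTop.eventually_ge_atTop K, eventually_gt_atTop 0]
      with n hn hn0
    refine Eventually.of_forall fun v hv => ?_
    rw [Set.uIoc_of_le hK] at hv
    have h := one_sub_div_pow_mem_Icc (n - d) (Nat.cast_pos.2 hn0) ⟨hv.1.le, hv.2.trans hn⟩
    have hv0 := pow_nonneg hv.1.le k
    rw [norm_of_nonneg (mul_nonneg hv0 h.1)]
    exact mul_le_of_le_one_right hv0 h.2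
  · exact Continuous.intervalIntegrable (by fun_prop) _ _
  · exact Eventually.of_forall fun v _ => (tendsto_one_sub_div_pow_sub d v).const_mul _

theorem tendsto_integral_pow_mul_exp_neg_s14 (k : ℕ) :
    Tendsto (fun K : ℝ => ∫ v in (0:ℝ)..K, v ^ k * exp (-v)) atTop
      (nhds (Nat.factorial k : ℝ)) := by
  have h := MeasureTheory.intervalIntegral_tendsto_integral_Ioi 0
    (integrableOn_pow_mul_exp_neg_mul k one_pos) tendsto_id
  rw [integral_Ioi_pow_mul_exp_neg_mul k one_pos] at h
  simpa using h

theorem tendsto_log_mul_div_log {c : ℝ} (hc : 0 < c) :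
    Tendsto (fun n : ℕ => log (n * c) / log n) atTop (nhds 1) := by
  have hlog : Tendsto (fun n : ℕ => log (n : ℝ)) atTop atTop :=
    tendsto_log_atTop.comp tendsto_natCast_atTop_atTop
  have h : Tendsto (fun n : ℕ => 1 + log c / log n) atTop (nhds (1 + 0)) :=
    (hlog.const_div_atTop _).const_add 1
  rw [add_zero] at h
  refine h.congr' ?_
  filter_upwards [hlog.eventually_gt_atTop 0, eventually_gt_atTop 0] with n hn hn0
  rw [log_mul (by positivity) hc.ne', add_div, div_self hn.ne']

theorem inner_integral_nonneg (k m : ℕ) {x s ε : ℝ} (hx : 0 < x) (hε : 0 ≤ ε) (hs : 0 ≤ s)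
    (hsε : s * ε ≤ x) : 0 ≤ ∫ t in (0:ℝ)..ε, s ^ k * t ^ k * (1 - s * t / x) ^ m := by
  apply intervalIntegral.integral_nonneg hε
  intro t ht
  have h := one_sub_div_pow_mem_Icc (v := s * t) m hx
    ⟨mul_nonneg hs ht.1, (mul_le_mul_of_nonneg_left ht.2 hs).trans hsε⟩
  exact mul_nonneg (mul_nonneg (pow_nonneg hs k) (pow_nonneg ht.1 k)) h.1

theorem inner_integral_le_pow (k m : ℕ) {x s ε : ℝ} (hx : 0 < x) (hε : 0 ≤ ε) (hs : 0 ≤ s)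
    (hs1 : s ≤ 1) (hsε : s * ε ≤ x) :
    ∫ t in (0:ℝ)..ε, s ^ k * t ^ k * (1 - s * t / x) ^ m ≤ ε ^ (k + 1) := by
  have hle : ∀ t ∈ Set.Icc 0 ε, s ^ k * t ^ k * (1 - s * t / x) ^ m ≤ ε ^ k := by
    intro t ht
    have h := one_sub_div_pow_mem_Icc (v := s * t) m hx
      ⟨mul_nonneg hs ht.1, (mul_le_mul_of_nonneg_left ht.2 hs).trans hsε⟩
    calc s ^ k * t ^ k * (1 - s * t / x) ^ m
        ≤ 1 * ε ^ k * 1 := by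
          have := ht.1
          gcongr
          · exact h.1
          · exact pow_le_one₀ hs hs1
          · exact ht.2
          · exact h.2
      _ = ε ^ k := by ring
  have h := intervalIntegral.integral_mono_on hε
    (Continuous.intervalIntegrable (by simp only [div_eq_mul_inv]; fun_prop) _ _)
    (intervalIntegrable_const (μ := MeasureTheory.volume)) hle
  refine h.trans_eq ?_
  rw [intervalIntegral.integral_const, smul_eq_mul]
  ring

theorem double_integral_le (k : ℕ) {m : ℕ} (hm : 0 < m) {x b ε : ℝ} (hx : 0 < x) (hε : 0 ≤ ε)
    (hb : 1 ≤ b) (hbε : b * ε ≤ x) :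
    ∫ s in (0:ℝ)..b, ∫ t in (0:ℝ)..ε, s ^ k * t ^ k * (1 - s * t / x) ^ m ≤
      ε ^ (k + 1) + (x / m) ^ (k + 1) * (Nat.factorial k : ℝ) * log b := by
  have hc := continuous_inner_integral k m x ε
  rw [← intervalIntegral.integral_add_adjacent_intervals (hc.intervalIntegrable 0 1)
    (hc.intervalIntegrable 1 b)]
  gcongr
  · have h := intervalIntegral.integral_mono_on zero_le_one (hc.intervalIntegrable 0 1)
      (intervalIntegrable_const (μ := MeasureTheory.volume)) fun s hs =>
        inner_integral_le_pow k m hx hε hs.1 hs.2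
          ((mul_le_mul_of_nonneg_right (hs.2.trans hb) hε).trans hbε)
    simpa using h
  · have h0 : (0:ℝ) ∉ Set.uIcc 1 b := by
      rw [Set.uIcc_of_le hb]; exact fun h => absurd h.1 (by norm_num)
    have h := intervalIntegral.integral_mono_on (μ := MeasureTheory.volume) hb
      (hc.intervalIntegrable 1 b)
      ((intervalIntegral.intervalIntegrable_inv (f := fun s : ℝ => s)
        (fun s hs h => h0 (h ▸ hs)) continuousOn_id).const_mul
          ((x / m) ^ (k + 1) * (Nat.factorial k : ℝ))) fun s hs => by
        have hs0 : 0 < s := by linarith [hs.1]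
        rw [← div_eq_mul_inv, le_div_iff₀' hs0, mul_integral_pow_mul_one_sub_pow]
        exact integral_pow_mul_one_sub_pow_le k hm hx
          ⟨by positivity, (mul_le_mul_of_nonneg_right hs.2 hε).trans hbε⟩
    rwa [intervalIntegral.integral_const_mul, integral_inv h0, div_one] at h

theorem le_double_integral (k m : ℕ) {x a b ε : ℝ} (hx : 0 < x) (hε : 0 ≤ ε) (ha : 0 < a)
    (hab : a ≤ b) (hbε : b * ε ≤ x) :
    (∫ v in (0:ℝ)..(a * ε), v ^ k * (1 - v / x) ^ m) * log (b / a) ≤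
      ∫ s in (0:ℝ)..b, ∫ t in (0:ℝ)..ε, s ^ k * t ^ k * (1 - s * t / x) ^ m := by
  have hc := continuous_inner_integral k m x ε
  have h0 : (0:ℝ) ∉ Set.uIcc a b := by
    rw [Set.uIcc_of_le hab]; exact fun h => absurd h.1 (by linarith)
  have hF := continuous_pow_mul_one_sub_div_pow k m x
  rw [← intervalIntegral.integral_add_adjacent_intervals (hc.intervalIntegrable 0 a)
    (hc.intervalIntegrable a b)]
  have hnn : 0 ≤ ∫ s in (0:ℝ)..a, ∫ t in (0:ℝ)..ε, s ^ k * t ^ k * (1 - s * t / x) ^ m :=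
    intervalIntegral.integral_nonneg ha.le fun s hs =>
      inner_integral_nonneg k m hx hε hs.1
        ((mul_le_mul_of_nonneg_right (hs.2.trans hab) hε).trans hbε)
  have h := intervalIntegral.integral_mono_on (μ := MeasureTheory.volume) hab
    ((intervalIntegral.intervalIntegrable_inv (f := fun s : ℝ => s)
      (fun s hs h => h0 (h ▸ hs)) continuousOn_id).const_mul
        (∫ v in (0:ℝ)..(a * ε), v ^ k * (1 - v / x) ^ m))
    (hc.intervalIntegrable a b) fun s hs => by
      have hs0 : 0 < s := ha.trans_le hs.1
      have hsε : a * ε ≤ s * ε := mul_le_mul_of_nonneg_right hs.1 hε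
      rw [← div_eq_mul_inv, div_le_iff₀' hs0, mul_integral_pow_mul_one_sub_pow,
        ← intervalIntegral.integral_add_adjacent_intervals (hF.intervalIntegrable 0 (a * ε))
          (hF.intervalIntegrable (a * ε) (s * ε))]
      refine le_add_of_nonneg_right (intervalIntegral.integral_nonneg hsε fun v hv => ?_)
      have hv0 : 0 ≤ v := (mul_nonneg ha.le hε).trans hv.1
      have hp := one_sub_div_pow_mem_Icc m hx
        ⟨hv0, hv.2.trans ((mul_le_mul_of_nonneg_right hs.2 hε).trans hbε)⟩
      exact mul_nonneg (pow_nonneg hv0 k) hp.1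
  rw [intervalIntegral.integral_const_mul, integral_inv h0] at h
  linarith

theorem tendsto_natCast_div_natCast_sub (d : ℕ) :
    Tendsto (fun n : ℕ => (n : ℝ) / ((n - d : ℕ) : ℝ)) atTop (nhds 1) := by
  have h0 : Tendsto (fun n : ℕ => (1 - (d : ℝ) / n)⁻¹) atTop (nhds 1) := by
    simpa using ((tendsto_const_div_atTop_nhds_zero_nat (d : ℝ)).const_sub 1).inv₀ (by simp)
  refine h0.congr' ?_
  filter_upwards [eventually_gt_atTop d] with n hn
  have hn0 : (n : ℝ) ≠ 0 := by exact_mod_cast (by omega : n ≠ 0)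
  rw [Nat.cast_sub hn.le, one_sub_div hn0, inv_div]

/-- Let d ≥ 1, α > 0, ε > 0 with α·ε ≤ 1. For n > d set
H(α,n) = ∫_0^{nα} ∫_0^ε s^{d−1} t^{d−1} (1 − st/n)^{n−d} dt ds. Then
H(α,n)/log n → (d−1)! as n → ∞. -/
theorem stmt_14 (d : ℕ) (hd : 1 ≤ d) (α ε : ℝ) (hα : 0 < α) (hε : 0 < ε)
    (hαε : α * ε ≤ 1) :
    Tendsto
      (fun n : ℕ =>
        (∫ s in (0:ℝ)..(n * α), ∫ t in (0:ℝ)..ε,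
          s ^ (d - 1) * t ^ (d - 1) * (1 - s * t / n) ^ (n - d)) /
            Real.log n)
      atTop (nhds ((Nat.factorial (d - 1) : ℝ))) := by
  have hn_top : Tendsto (fun n : ℕ => (n : ℝ)) atTop atTop := tendsto_natCast_atTop_atTop
  have hlog : Tendsto (fun n : ℕ => log (n : ℝ)) atTop atTop := tendsto_log_atTop.comp hn_top
  have hnα : Tendsto (fun n : ℕ => (n : ℝ) * α) atTop atTop := hn_top.atTop_mul_const hα
  have hle (n : ℕ) : (n : ℝ) * α * ε ≤ n := by
    rw [mul_assoc]
    exact mul_le_of_le_one_right n.cast_nonneg hαε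
  obtain ⟨k, rfl⟩ : ∃ k, d = k + 1 := ⟨d - 1, by omega⟩
  simp only [Nat.add_sub_cancel]
  refine tendsto_order.2 ⟨fun a ha => ?_, fun a ha => ?_⟩
  · obtain ⟨a', haa', ha'⟩ := exists_between ha
    obtain ⟨K, hKa, hK⟩ := (((tendsto_integral_pow_mul_exp_neg_s14 k).eventually_const_lt ha').and
      (eventually_gt_atTop 0)).exists
    have hlim : Tendsto (fun n : ℕ => a' * (log (n * (α / (K / ε))) / log n)) atTop
        (nhds a') := by
      simpa using (tendsto_log_mul_div_log (by positivity : 0 < α / (K / ε))).const_mul a'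
    filter_upwards [hlim.eventually_const_lt haa',
      (tendsto_integral_pow_mul_one_sub_pow k (k + 1) hK.le).eventually_const_lt hKa,
      hlog.eventually_gt_atTop 0, hnα.eventually_ge_atTop (K / ε), eventually_gt_atTop 0]
      with n hn hnK hln hnα hn0
    refine hn.trans_le ?_
    have hKε : 0 < K / ε := by positivity
    have h := le_double_integral k (n - (k + 1)) (Nat.cast_pos.2 hn0) hε.le hKε hnα (hle n)
    rw [div_mul_cancel₀ _ hε.ne', mul_div_assoc] at h
    rw [← mul_div_assoc]
    gcongr
    refine le_trans ?_ h
    gcongr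
    rw [← mul_div_assoc]
    exact log_nonneg ((one_le_div hKε).2 hnα)
  · have hlim : Tendsto (fun n : ℕ => ε ^ (k + 1) / log n +
        ((n : ℝ) / ((n - (k + 1) : ℕ) : ℝ)) ^ (k + 1) * (Nat.factorial k : ℝ) *
          (log (n * α) / log n)) atTop (nhds (Nat.factorial k : ℝ)) := by
      simpa using (hlog.const_div_atTop (ε ^ (k + 1))).add
        ((((tendsto_natCast_div_natCast_sub (k + 1)).pow (k + 1)).mul_const
          (Nat.factorial k : ℝ)).mul (tendsto_log_mul_div_log hα))
    filter_upwards [hlim.eventually_lt_const ha, hlog.eventually_gt_atTop 0,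
      hnα.eventually_ge_atTop 1, eventually_gt_atTop (k + 1)] with n hn hln hnα hnk
    refine lt_of_le_of_lt ?_ hn
    rw [← mul_div_assoc, ← add_div]
    gcongr
    exact double_integral_le k (by omega) (Nat.cast_pos.2 (by omega)) hε.le hnα (hle n)
end

section
/- Let φ, ψ, φ̃, ψ̃ ∈ (0,π/2) satisfy the Napier relations tan φ̃ = (tan ψ)(sin φ) and tan φ = (tan ψ̃)(sin φ̃). Then sin φ = (tan ψ̃)(sin φ̃)/√(1 + (tan ψ̃)²(sin φ̃)²) and sin ψ = (cos ψ̃)·√(1 + (tan ψ̃)²(sin φ̃)²). -/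
open Real

/-- For an acute angle `x`, `√(1 + tan² x)` is the secant of `x`. -/
theorem sqrt_one_add_tan_sq {x : ℝ} (hx : 0 < Real.cos x) :
    Real.sqrt (1 + Real.tan x ^ 2) = (Real.cos x)⁻¹ := by
  rw [← Real.inv_sqrt_one_add_tan_sq hx, inv_inv]

/-- Napier relations: if φ, ψ, φ̃, ψ̃ ∈ (0,π/2) satisfy
tan φ̃ = (tan ψ)(sin φ) and tan φ = (tan ψ̃)(sin φ̃), then
sin φ = (tan ψ̃)(sin φ̃)/√(1 + (tan ψ̃)²(sin φ̃)²) and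
sin ψ = (cos ψ̃)·√(1 + (tan ψ̃)²(sin φ̃)²). -/
theorem stmt_16 (φ ψ φt ψt : ℝ)
    (hφ : φ ∈ Set.Ioo 0 (π/2)) (hψ : ψ ∈ Set.Ioo 0 (π/2))
    (hφt : φt ∈ Set.Ioo 0 (π/2)) (hψt : ψt ∈ Set.Ioo 0 (π/2))
    (h1 : Real.tan φt = Real.tan ψ * Real.sin φ)
    (h2 : Real.tan φ = Real.tan ψt * Real.sin φt) :
    Real.sin φ = Real.tan ψt * Real.sin φt /
        Real.sqrt (1 + Real.tan ψt ^ 2 * Real.sin φt ^ 2) ∧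
    Real.sin ψ = Real.cos ψt *
        Real.sqrt (1 + Real.tan ψt ^ 2 * Real.sin φt ^ 2) := by
  have acute : ∀ x ∈ Set.Ioo (0 : ℝ) (π / 2), 0 < Real.sin x ∧ 0 < Real.cos x := fun x hx =>
    ⟨Real.sin_pos_of_pos_of_lt_pi hx.1 (by linarith [hx.2, Real.pi_pos]),
      Real.cos_pos_of_mem_Ioo ⟨by linarith [hx.1, Real.pi_pos], hx.2⟩⟩
  obtain ⟨hs, hc⟩ := acute φ hφ
  obtain ⟨hp, hq⟩ := acute ψ hψ
  obtain ⟨ha, hb⟩ := acute φt hφt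
  obtain ⟨hu, hv⟩ := acute ψt hψt
  rw [← mul_pow, ← h2, sqrt_one_add_tan_sq hc]
  refine ⟨by rw [div_inv_eq_mul, Real.tan_mul_cos hc.ne'], ?_⟩
  rw [Real.tan_eq_sin_div_cos, Real.tan_eq_sin_div_cos] at h1 h2
  have e1 : Real.sin φt * Real.cos ψ = Real.cos φt * Real.sin ψ * Real.sin φ := by
    field_simp at h1
    linarith
  have e2 : Real.sin φ * Real.cos ψt = Real.sin ψt * Real.sin φt * Real.cos φ := by
    field_simp at h2
    linarith
  have f1 : Real.sin φt ^ 2 * (1 - Real.sin ψ ^ 2 * Real.cos φ ^ 2)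
      = Real.sin ψ ^ 2 * Real.sin φ ^ 2 := by
    have h := congrArg (· ^ 2) e1
    simp only [mul_pow, Real.cos_sq' φt, Real.cos_sq' ψ] at h
    rw [Real.cos_sq' φ]
    linarith
  have f2 : Real.cos ψt ^ 2 * (Real.sin φ ^ 2 + Real.sin φt ^ 2 * Real.cos φ ^ 2)
      = Real.sin φt ^ 2 * Real.cos φ ^ 2 := by
    have h := congrArg (· ^ 2) e2
    simp only [mul_pow, Real.sin_sq ψt] at h
    linarith
  have f3 : Real.sin φ ^ 2 * (Real.sin ψ * Real.cos φ) ^ 2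
      = Real.sin φ ^ 2 * Real.cos ψt ^ 2 := by
    linear_combination (Real.cos ψt ^ 2 * Real.cos φ ^ 2 - Real.cos φ ^ 2) * f1
      - (1 - Real.sin ψ ^ 2 * Real.cos φ ^ 2) * f2
  rw [← div_eq_mul_inv, eq_div_iff hc.ne']
  exact (sq_eq_sq₀ (by positivity) hv.le).mp (mul_left_cancel₀ (by positivity) f3)
end

section
/- Let d ≥ 2 be an integer and let φ, ψ, φ̃, ψ̃ ∈ (0,π/2) satisfy tan φ̃ = (tan ψ)(sin φ) and tan φ = (tan ψ̃)(sin φ̃). Then (sin φ)^{d−2}·(sin ψ)^{d−1}·(tan ψ̃)/√(1 + (tan ψ̃)²(sin φ̃)²) = (sin φ̃)^{d−2}·(sin ψ̃)^{d−1}. -/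
open Real

/-- The Napier relation `tan β = tan y * sin x`, with cosines eliminated. -/
lemma sin_sq_mul_eq_of_tan_eq {x y β : ℝ} (hy : cos y ≠ 0) (hβ : cos β ≠ 0)
    (h : tan β = tan y * sin x) :
    sin y ^ 2 * (sin x ^ 2 + sin β ^ 2 - sin x ^ 2 * sin β ^ 2) = sin β ^ 2 := by
  have e : sin β * cos y = sin y * sin x * cos β := by
    rw [tan_eq_sin_div_cos, tan_eq_sin_div_cos] at h
    field_simp at h
    linarith
  have e2 : sin β ^ 2 * cos y ^ 2 = sin y ^ 2 * sin x ^ 2 * cos β ^ 2 := by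
    linear_combination (sin β * cos y + sin y * sin x * cos β) * e
  rw [cos_sq', cos_sq'] at e2
  linear_combination -e2

/-- Invariance of the spherical-coordinate density under the reflection of the
right-angled spherical wedge: with the Napier relations as hypotheses,
(sin φ)^{d−2}·(sin ψ)^{d−1}·(tan ψ̃)/√(1 + (tan ψ̃)²(sin φ̃)²)
  = (sin φ̃)^{d−2}·(sin ψ̃)^{d−1}. -/
theorem stmt_17 (d : ℕ) (hd : 2 ≤ d) (φ ψ φt ψt : ℝ)
    (hφ : φ ∈ Set.Ioo 0 (π/2)) (hψ : ψ ∈ Set.Ioo 0 (π/2))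
    (hφt : φt ∈ Set.Ioo 0 (π/2)) (hψt : ψt ∈ Set.Ioo 0 (π/2))
    (h1 : Real.tan φt = Real.tan ψ * Real.sin φ)
    (h2 : Real.tan φ = Real.tan ψt * Real.sin φt) :
    Real.sin φ ^ (d - 2) * Real.sin ψ ^ (d - 1) *
        (Real.tan ψt / Real.sqrt (1 + Real.tan ψt ^ 2 * Real.sin φt ^ 2)) =
      Real.sin φt ^ (d - 2) * Real.sin ψt ^ (d - 1) := by
  have sφ : 0 < sin φ := sin_pos_of_pos_of_lt_pi hφ.1 (by linarith [hφ.2, pi_pos])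
  have sψ : 0 < sin ψ := sin_pos_of_pos_of_lt_pi hψ.1 (by linarith [hψ.2, pi_pos])
  have sφt : 0 < sin φt := sin_pos_of_pos_of_lt_pi hφt.1 (by linarith [hφt.2, pi_pos])
  have sψt : 0 < sin ψt := sin_pos_of_pos_of_lt_pi hψt.1 (by linarith [hψt.2, pi_pos])
  have cφ : 0 < cos φ := cos_pos_of_mem_Ioo ⟨by linarith [hφ.1, pi_pos], hφ.2⟩
  have cψ : 0 < cos ψ := cos_pos_of_mem_Ioo ⟨by linarith [hψ.1, pi_pos], hψ.2⟩
  have cφt : 0 < cos φt := cos_pos_of_mem_Ioo ⟨by linarith [hφt.1, pi_pos], hφt.2⟩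
  have cψt : 0 < cos ψt := cos_pos_of_mem_Ioo ⟨by linarith [hψt.1, pi_pos], hψt.2⟩
  have jacobian : tan ψt / √(1 + tan ψt ^ 2 * sin φt ^ 2) = sin φ / sin φt := by
    have hsqrt : √(1 + tan ψt ^ 2 * sin φt ^ 2) = (cos φ)⁻¹ := by
      rw [← mul_pow, ← h2, ← inv_inv (√_), inv_sqrt_one_add_tan_sq cφ]
    rw [hsqrt, div_inv_eq_mul, eq_div_iff sφt.ne', ← tan_mul_cos cφ.ne', h2]
    ring
  have height : sin φ * sin ψ = sin φt * sin ψt := by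
    have e1 := sin_sq_mul_eq_of_tan_eq cψ.ne' cφt.ne' h1
    have e2 := sin_sq_mul_eq_of_tan_eq cψt.ne' cφ.ne' h2
    have hD : sin φ ^ 2 + sin φt ^ 2 - sin φ ^ 2 * sin φt ^ 2 ≠ 0 := by
      intro h
      rw [h, mul_zero] at e1
      exact (pow_pos sφt 2).ne e1
    rw [← sq_eq_sq₀ (by positivity) (by positivity)]
    refine mul_right_cancel₀ hD ?_
    linear_combination sin φ ^ 2 * e1 - sin φt ^ 2 * e2
  obtain ⟨n, rfl⟩ := Nat.exists_eq_add_of_le' hd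
  have hpow : (sin φ * sin ψ) ^ (n + 1) = (sin φt * sin ψt) ^ (n + 1) := by rw [height]
  rw [jacobian, Nat.add_sub_cancel, show n + 2 - 1 = n + 1 from rfl, mul_div_assoc',
    div_eq_iff sφt.ne']
  rw [mul_pow, mul_pow] at hpow
  linear_combination hpow
end

section
/- Let φ, ψ, φ̃, ψ̃ ∈ (0,π/2) satisfy tan φ̃ = (tan ψ)(sin φ) and tan φ = (tan ψ̃)(sin φ̃). If tan ψ > 1/cos φ, then tan ψ̃ < 1/cos φ̃. -/
open Real

/-- With the Napier relations as hypotheses: if tan ψ > 1/cos φ, then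
tan ψ̃ < 1/cos φ̃. -/
theorem stmt_18 (φ ψ φt ψt : ℝ)
    (hφ : φ ∈ Set.Ioo 0 (π/2)) (hψ : ψ ∈ Set.Ioo 0 (π/2))
    (hφt : φt ∈ Set.Ioo 0 (π/2)) (hψt : ψt ∈ Set.Ioo 0 (π/2))
    (h1 : Real.tan φt = Real.tan ψ * Real.sin φ)
    (h2 : Real.tan φ = Real.tan ψt * Real.sin φt)
    (h3 : Real.tan ψ > 1 / Real.cos φ) :
    Real.tan ψt < 1 / Real.cos φt := by
  have hsin : 0 < Real.sin φ := Real.sin_pos_of_pos_of_lt_pi hφ.1 (by linarith [hφ.2, Real.pi_pos])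
  have hsint : 0 < Real.sin φt :=
    Real.sin_pos_of_pos_of_lt_pi hφt.1 (by linarith [hφt.2, Real.pi_pos])
  have htan : Real.tan φ < Real.tan φt := by
    rw [h1, Real.tan_eq_sin_div_cos φ, div_eq_mul_one_div, mul_comm]
    exact mul_lt_mul_of_pos_right h3 hsin
  rw [h2, Real.tan_eq_sin_div_cos φt, div_eq_mul_one_div, mul_comm (Real.sin φt)] at htan
  exact lt_of_mul_lt_mul_right htan hsint.le
end
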